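/- arXiv:2310.18739 — 8 statements merged into one kernel-verified Lean document; each statement's English description precedes it below -/
import Mathlib

section
/- Let n, r ≥ 1, let ξ₁,…,ξᵣ : ℝⁿ → ℝⁿ and ξ : ℝⁿ → ℝⁿ be differentiable vector fields, let u₁,…,uᵣ : ℝ → ℝ, and let x, p : ℝ → ℝⁿ be curves differentiable at t₀ satisfying x'(t₀) = Σᵢ uᵢ(t₀) ξᵢ(x(t₀)) and ⟨p'(t₀), v⟩ = −Σᵢ uᵢ(t₀) ⟨p(t₀), Dξᵢ(x(t₀))(v)⟩ for every v ∈ ℝⁿ (the constrained Hamiltonian equations for the distribution spanned by ξ₁,…,ξᵣ). Then the function t ↦ ⟨p(t), ξ(x(t))⟩ is differentiable at t₀ with derivative Σᵢ uᵢ(t₀) ⟨p(t₀), [ξᵢ, ξ](x(t₀))⟩. -/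
open scoped RealInnerProductSpace
open Finset

/-- Along a solution of the constrained Hamiltonian system of the distribution
spanned by the vector fields ξ₁,…,ξᵣ, the Hamiltonian H_ξ(x,p) = ⟪p, ξ(x)⟫ of
any vector field ξ differentiates to Σᵢ uᵢ H_{[ξᵢ,ξ]}. -/
theorem deriv_hamiltonian_along_bicharacteristic
    (n r : ℕ) (hn : 1 ≤ n) (hr : 1 ≤ r)
    (ξs : Fin r → (EuclideanSpace ℝ (Fin n) → EuclideanSpace ℝ (Fin n)))
    (ξ : EuclideanSpace ℝ (Fin n) → EuclideanSpace ℝ (Fin n))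
    (hξs : ∀ i, Differentiable ℝ (ξs i)) (hξ : Differentiable ℝ ξ)
    (u : Fin r → ℝ → ℝ) (x p : ℝ → EuclideanSpace ℝ (Fin n)) (t₀ : ℝ)
    (hx : HasDerivAt x (∑ i, u i t₀ • ξs i (x t₀)) t₀)
    (p' : EuclideanSpace ℝ (Fin n)) (hp : HasDerivAt p p' t₀)
    (hp' : ∀ v : EuclideanSpace ℝ (Fin n),
      ⟪p', v⟫ = -∑ i, u i t₀ * ⟪p t₀, fderiv ℝ (ξs i) (x t₀) v⟫) :
    HasDerivAt (fun t => ⟪p t, ξ (x t)⟫)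
      (∑ i, u i t₀ * ⟪p t₀, VectorField.lieBracket ℝ (ξs i) ξ (x t₀)⟫) t₀ := by
  have hξx := (hξ (x t₀)).hasFDerivAt.comp_hasDerivAt t₀ hx
  refine (hp.inner ℝ hξx).congr_deriv ?_
  simp only [Function.comp_apply, hp', map_sum, map_smul, inner_sum, inner_smul_right,
    VectorField.lieBracket, inner_sub_right, mul_sub, Finset.sum_sub_distrib]
  ring
end

section
/- Let x₁³, x₁⁴, x₁⁵, x₁⁶, x₂³, x₂⁴, x₂⁵, x₂⁶ : ℝ → ℝ be differentiable functions such that x₂⁶(t) = x₁⁵(t) − x₁³(t)x₂⁴(t) + x₁⁴(t)x₂³(t) for all t, and suppose that for all t: (x₁⁶)'(t) + x₁³(t)(x₁⁴)'(t) − x₁⁴(t)(x₁³)'(t) = 0, (x₁⁵)'(t) + x₂³(t)(x₁⁴)'(t) − x₂⁴(t)(x₁³)'(t) = 0, and (x₂⁵)'(t) + x₂³(t)(x₂⁴)'(t) − x₂⁴(t)(x₂³)'(t) = 0. Then also (x₂⁶)'(t) + x₁³(t)(x₂⁴)'(t) − x₁⁴(t)(x₂³)'(t) = 0 for all t. (Thus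 for curves in the isotropic Grassmannian, the equation Ω(h₁, h₂') = 0 follows from the other three tangency equations.) -/
/-- For curves in the isotropic Grassmannian of (ℝ⁶, Ω), the tangency equation
Ω(h₁, h₂') = 0 follows from the isotropy constraint
x₂⁶ = x₁⁵ − x₁³x₂⁴ + x₁⁴x₂³ together with the other three tangency
equations Ω(h₁,h₁') = 0, Ω(h₂,h₁') = 0, Ω(h₂,h₂') = 0. -/
theorem fourth_tangency_equation
    (a13 a14 a15 a16 a23 a24 a25 a26 : ℝ → ℝ)
    (h13 : Differentiable ℝ a13) (h14 : Differentiable ℝ a14)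
    (h15 : Differentiable ℝ a15) (h16 : Differentiable ℝ a16)
    (h23 : Differentiable ℝ a23) (h24 : Differentiable ℝ a24)
    (h25 : Differentiable ℝ a25) (h26 : Differentiable ℝ a26)
    (hconstraint : ∀ t, a26 t = a15 t - a13 t * a24 t + a14 t * a23 t)
    (e1 : ∀ t, deriv a16 t + a13 t * deriv a14 t - a14 t * deriv a13 t = 0)
    (e2 : ∀ t, deriv a15 t + a23 t * deriv a14 t - a24 t * deriv a13 t = 0)
    (e3 : ∀ t, deriv a25 t + a23 t * deriv a24 t - a24 t * deriv a23 t = 0) :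
    ∀ t, deriv a26 t + a13 t * deriv a24 t - a14 t * deriv a23 t = 0 := by
  intro t
  have h : HasDerivAt a26 (deriv a15 t - (deriv a13 t * a24 t + a13 t * deriv a24 t) +
      (deriv a14 t * a23 t + a14 t * deriv a23 t)) t := by
    rw [funext hconstraint]
    exact ((h15 t).hasDerivAt.sub ((h13 t).hasDerivAt.mul (h24 t).hasDerivAt)).add
      ((h14 t).hasDerivAt.mul (h23 t).hasDerivAt)
  rw [h.deriv]
  linear_combination e2 t
end

section
/- On ℝ⁷ with coordinates (x₁³, x₁⁴, x₁⁵, x₁⁶, x₂³, x₂⁴, x₂⁵), the vector fields ξ₁, ξ₂, ξ₃, ξ₄ of the isotropic-Grassmannian model satisfy: [ξ₁,ξ₂] = 0, [ξ₃,ξ₄] = 0, [ξ₁,ξ₃] = −2∂/∂x₁⁶, [ξ₁,ξ₄] = −∂/∂x₁⁵, [ξ₂,ξ₃] = −∂/∂x₁⁵, and [ξ₂,ξ₄] = −2∂/∂x₂⁵, as equalities of maps ℝ⁷ → ℝ⁷. In particular [ξ₁,ξ₂] = 0, [ξ₃,ξ₄] = 0 and [ξ₁,ξ₄] = [ξ₂,ξ₃],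 the structure relations of a hyperbolic (4,7)-distribution. -/
/- The isotropic-Grassmannian model on ℝ⁷ with coordinates
(x₁³, x₁⁴, x₁⁵, x₁⁶, x₂³, x₂⁴, x₂⁵), indexed by 0,…,6. Vector fields are
identified with maps ℝ⁷ → ℝ⁷ of their coefficients in the coordinate frame. -/

def xi1 (q : Fin 7 → ℝ) : Fin 7 → ℝ := ![1, 0, q 5, q 1, 0, 0, 0]
def xi2 (q : Fin 7 → ℝ) : Fin 7 → ℝ := ![0, 0, 0, 0, 1, 0, q 5]
def xi3 (q : Fin 7 → ℝ) : Fin 7 → ℝ := ![0, 1, -q 4, -q 0, 0, 0, 0]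
def xi4 (q : Fin 7 → ℝ) : Fin 7 → ℝ := ![0, 0, 0, 0, 0, 1, -q 4]

theorem fderiv_apply_coord {ι : Type*} [Fintype ι] {f : (ι → ℝ) → ι → ℝ} {q : ι → ℝ}
    (h : DifferentiableAt ℝ f q) (v : ι → ℝ) (i : ι) :
    fderiv ℝ f q v i = fderiv ℝ (fun x => f x i) q v := by
  simp [fderiv_apply h]

theorem fderiv_xi1_apply (q v : Fin 7 → ℝ) :
    fderiv ℝ xi1 q v = ![0, 0, v 5, v 1, 0, 0, 0] := by
  have h : DifferentiableAt ℝ xi1 q := by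
    refine differentiableAt_pi.2 fun i => ?_
    fin_cases i <;> simp [xi1] <;> fun_prop
  ext i
  rw [fderiv_apply_coord h]
  fin_cases i <;> simp [xi1, fderiv_apply]

theorem fderiv_xi2_apply (q v : Fin 7 → ℝ) :
    fderiv ℝ xi2 q v = ![0, 0, 0, 0, 0, 0, v 5] := by
  have h : DifferentiableAt ℝ xi2 q := by
    refine differentiableAt_pi.2 fun i => ?_
    fin_cases i <;> simp [xi2]
    fun_prop
  ext i
  rw [fderiv_apply_coord h]
  fin_cases i <;> simp [xi2, fderiv_apply]

theorem fderiv_xi3_apply (q v : Fin 7 → ℝ) :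
    fderiv ℝ xi3 q v = ![0, 0, -v 4, -v 0, 0, 0, 0] := by
  have h : DifferentiableAt ℝ xi3 q := by
    refine differentiableAt_pi.2 fun i => ?_
    fin_cases i <;> simp [xi3] <;> fun_prop
  ext i
  rw [fderiv_apply_coord h]
  fin_cases i <;> simp [xi3, fderiv_apply]

theorem fderiv_xi4_apply (q v : Fin 7 → ℝ) :
    fderiv ℝ xi4 q v = ![0, 0, 0, 0, 0, 0, -v 4] := by
  have h : DifferentiableAt ℝ xi4 q := by
    refine differentiableAt_pi.2 fun i => ?_
    fin_cases i <;> simp [xi4]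
    fun_prop
  ext i
  rw [fderiv_apply_coord h]
  fin_cases i <;> simp [xi4, fderiv_apply]

/-- Bracket relations of the frame of the canonical distribution on the
isotropic Grassmannian: [ξ₁,ξ₂] = 0, [ξ₃,ξ₄] = 0, [ξ₁,ξ₃] = −2∂/∂x₁⁶,
[ξ₁,ξ₄] = −∂/∂x₁⁵, [ξ₂,ξ₃] = −∂/∂x₁⁵, [ξ₂,ξ₄] = −2∂/∂x₂⁵; in particular
[ξ₁,ξ₄] = [ξ₂,ξ₃], the structure relations of a hyperbolic
(4,7)-distribution. -/
theorem isotropic_grassmannian_brackets :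
    VectorField.lieBracket ℝ xi1 xi2 = (fun _ => (0 : Fin 7 → ℝ)) ∧
    VectorField.lieBracket ℝ xi3 xi4 = (fun _ => (0 : Fin 7 → ℝ)) ∧
    VectorField.lieBracket ℝ xi1 xi3 = (fun _ => ![0, 0, 0, -2, 0, 0, 0]) ∧
    VectorField.lieBracket ℝ xi1 xi4 = (fun _ => ![0, 0, -1, 0, 0, 0, 0]) ∧
    VectorField.lieBracket ℝ xi2 xi3 = (fun _ => ![0, 0, -1, 0, 0, 0, 0]) ∧
    VectorField.lieBracket ℝ xi2 xi4 = (fun _ => ![0, 0, 0, 0, 0, 0, -2]) ∧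
    VectorField.lieBracket ℝ xi1 xi4 = VectorField.lieBracket ℝ xi2 xi3 := by
  refine ⟨?_, ?_, ?_, ?_, ?_, ?_, ?_⟩ <;>
  · funext q i
    simp only [VectorField.lieBracket, fderiv_xi1_apply, fderiv_xi2_apply, fderiv_xi3_apply,
      fderiv_xi4_apply]
    simp only [xi1, xi2, xi3, xi4, Matrix.cons_val]
    fin_cases i <;> norm_num
end

section
/- On ℝ⁷ with coordinates (x₁³, x₁⁴, x₁⁵, x₁⁶, x₂³, x₂⁴, x₂⁵), at every point q ∈ ℝ⁷ the seven vectors ξ₁(q), ξ₂(q), ξ₃(q), ξ₄(q), ξ₅(q) = −2∂/∂x₁⁶, ξ₆(q) = −∂/∂x₁⁵, ξ₇(q) = −2∂/∂x₂⁵ form a basis of ℝ⁷. (Thus ξ₁,…,ξ₄ together with the brackets ξ₅ = [ξ₁,ξ₃], ξ₆ = [ξ₁,ξ₄], ξ₇ = [ξ₂,ξ₄] form a global frame, so the canonical distribution on the isotropic Grassmannian is a (4,7)-distribution.) -/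
def xi5 (_ : Fin 7 → ℝ) : Fin 7 → ℝ := ![0, 0, 0, -2, 0, 0, 0]
def xi6 (_ : Fin 7 → ℝ) : Fin 7 → ℝ := ![0, 0, -1, 0, 0, 0, 0]
def xi7 (_ : Fin 7 → ℝ) : Fin 7 → ℝ := ![0, 0, 0, 0, 0, 0, -2]

/-- At every point q ∈ ℝ⁷ the seven vectors ξ₁(q),…,ξ₇(q) form a basis of ℝ⁷,
so the canonical distribution on the isotropic Grassmannian together with one
round of brackets spans the whole tangent space: a (4,7)-distribution. -/
theorem isotropic_grassmannian_frame (q : Fin 7 → ℝ) :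
    LinearIndependent ℝ
        ![xi1 q, xi2 q, xi3 q, xi4 q, xi5 q, xi6 q, xi7 q] ∧
      Submodule.span ℝ
        (Set.range ![xi1 q, xi2 q, xi3 q, xi4 q, xi5 q, xi6 q, xi7 q]) = ⊤ := by
  have h : LinearIndependent ℝ
      ![xi1 q, xi2 q, xi3 q, xi4 q, xi5 q, xi6 q, xi7 q] := by
    rw [Fintype.linearIndependent_iff]
    intro c hc
    have hcoord : ∀ j : Fin 7,
        (∑ i, c i • ![xi1 q, xi2 q, xi3 q, xi4 q, xi5 q, xi6 q, xi7 q] i) j = 0 :=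
      fun j => congrFun hc j
    simp only [Fin.forall_fin_succ, Fin.sum_univ_succ] at hcoord
    simp [xi1, xi2, xi3, xi4, xi5, xi6, xi7] at hcoord
    obtain ⟨h0, h2, h5, h4, h1, h3, h6⟩ := hcoord
    simp only [h0, h1, h2, h3, zero_mul, neg_zero, zero_add] at h4 h5 h6
    intro i
    fin_cases i <;> simp only [Fin.reduceFinMk, Fin.zero_eta, Fin.mk_one] <;> linarith
  exact ⟨h, h.span_eq_top_of_card_eq_finrank' (by simp)⟩
end

section
/- Fix ε ∈ ℝ and consider the prolongation vector fields on ℝ⁹. Then, as equalities of maps ℝ⁹ → ℝ⁹: [ζ₁,ζ₂] = ζ₄, [ζ₁,ζ₃] = 0, [ζ₂,ζ₃] = ζ₅, [ζ₁,ζ₄] = 0, [ζ₂,ζ₄] = 0, [ζ₃,ζ₄] = ξ̂₄ = −ζ₆, [ζ₁,ζ₅] = ζ₆, [ζ₂,ζ₅] = ζ₇, and [ζ₃,ζ₅] = 0. -/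
/- The prolongation of the ε-family on ℝ⁹ = ℝ⁷ × ℝ² with coordinates
(x, y, s, t, z, w, u, θ, φ), indexed by 0,…,8. Vector fields are identified
with maps ℝ⁹ → ℝ⁹ of their coefficients; ξ̂ᵢ is the lift of ξᵢ from ℝ⁷. -/

def xi1h (ε : ℝ) (p : Fin 9 → ℝ) : Fin 9 → ℝ :=
  ![1, 0, p 5 + ε * p 3, p 1, 0, 0, 0, 0, 0]
def xi2h (p : Fin 9 → ℝ) : Fin 9 → ℝ := ![0, 0, 0, 0, 1, 0, p 5, 0, 0]
def xi3h (ε : ℝ) (p : Fin 9 → ℝ) : Fin 9 → ℝ :=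
  ![0, 1, -(p 4 - ε * p 3), -p 0, 0, 0, 0, 0, 0]
def xi4h (p : Fin 9 → ℝ) : Fin 9 → ℝ := ![0, 0, 0, 0, 0, 1, -p 4, 0, 0]
def xi5h (ε : ℝ) (p : Fin 9 → ℝ) : Fin 9 → ℝ :=
  ![0, 0, ε * (p 0 + p 1), -2, 0, 0, 0, 0, 0]
def xi6h (_ : Fin 9 → ℝ) : Fin 9 → ℝ := ![0, 0, -1, 0, 0, 0, 0, 0, 0]
def xi7h (_ : Fin 9 → ℝ) : Fin 9 → ℝ := ![0, 0, 0, 0, 0, 0, -2, 0, 0]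

def zeta1 (_ : Fin 9 → ℝ) : Fin 9 → ℝ := ![0, 0, 0, 0, 0, 0, 0, 1, 0]
def zeta2 (ε : ℝ) (p : Fin 9 → ℝ) : Fin 9 → ℝ :=
  xi1h ε p + p 7 • xi2h p + p 8 • xi3h ε p + (p 7 * p 8) • xi4h p
def zeta3 (_ : Fin 9 → ℝ) : Fin 9 → ℝ := ![0, 0, 0, 0, 0, 0, 0, 0, 1]
def zeta4 (p : Fin 9 → ℝ) : Fin 9 → ℝ := xi2h p + p 8 • xi4h p
def zeta5 (ε : ℝ) (p : Fin 9 → ℝ) : Fin 9 → ℝ := -xi3h ε p - p 7 • xi4h p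
def zeta6 (p : Fin 9 → ℝ) : Fin 9 → ℝ := -xi4h p
def zeta7 (ε : ℝ) (p : Fin 9 → ℝ) : Fin 9 → ℝ :=
  -(xi5h ε p + (2 * p 7) • xi6h p + (p 7 ^ 2) • xi7h p)
def zeta8 (p : Fin 9 → ℝ) : Fin 9 → ℝ := -(xi6h p + p 7 • xi7h p)
def zeta9 (p : Fin 9 → ℝ) : Fin 9 → ℝ := -xi7h p

theorem VectorField.lieBracket_apply_pi {ι : Type*} [Fintype ι] {V W : (ι → ℝ) → ι → ℝ}
    (hV : Differentiable ℝ V) (hW : Differentiable ℝ W) (p : ι → ℝ) (i : ι) :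
    VectorField.lieBracket ℝ V W p i =
      fderiv ℝ (fun q => W q i) p (V p) - fderiv ℝ (fun q => V q i) p (W p) := by
  rw [VectorField.lieBracket, Pi.sub_apply, fderiv_apply (hW p) i, fderiv_apply (hV p) i]
  rfl

theorem fderiv_coord_apply {ι : Type*} [Fintype ι] (i : ι) (p v : ι → ℝ) :
    fderiv ℝ (fun q : ι → ℝ => q i) p v = v i := by
  rw [(hasFDerivAt_apply i p).fderiv]
  rfl

theorem differentiable_zeta1 : Differentiable ℝ zeta1 := differentiable_const _

theorem differentiable_zeta2 (ε : ℝ) : Differentiable ℝ (zeta2 ε) := by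
  rw [differentiable_pi]
  intro i
  fin_cases i <;> simp [zeta2, xi1h, xi2h, xi3h, xi4h] <;> fun_prop

theorem differentiable_zeta3 : Differentiable ℝ zeta3 := differentiable_const _

theorem differentiable_zeta4 : Differentiable ℝ zeta4 := by
  rw [differentiable_pi]
  intro i
  fin_cases i <;> simp [zeta4, xi2h, xi4h] <;> fun_prop

theorem differentiable_zeta5 (ε : ℝ) : Differentiable ℝ (zeta5 ε) := by
  rw [differentiable_pi]
  intro i
  fin_cases i <;> simp [zeta5, xi3h, xi4h] <;> fun_prop

/-- First-level bracket relations of the prolongation of the ε-family: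
[ζ₁,ζ₂] = ζ₄, [ζ₁,ζ₃] = 0, [ζ₂,ζ₃] = ζ₅, [ζ₁,ζ₄] = 0, [ζ₂,ζ₄] = 0,
[ζ₃,ζ₄] = ξ̂₄ = −ζ₆, [ζ₁,ζ₅] = ζ₆, [ζ₂,ζ₅] = ζ₇, [ζ₃,ζ₅] = 0. -/
theorem prolongation_brackets (ε : ℝ) :
    VectorField.lieBracket ℝ zeta1 (zeta2 ε) = zeta4 ∧
    VectorField.lieBracket ℝ zeta1 zeta3 = (fun _ => (0 : Fin 9 → ℝ)) ∧
    VectorField.lieBracket ℝ (zeta2 ε) zeta3 = zeta5 ε ∧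
    VectorField.lieBracket ℝ zeta1 zeta4 = (fun _ => (0 : Fin 9 → ℝ)) ∧
    VectorField.lieBracket ℝ (zeta2 ε) zeta4 = (fun _ => (0 : Fin 9 → ℝ)) ∧
    VectorField.lieBracket ℝ zeta3 zeta4 = xi4h ∧
    xi4h = (fun p => -zeta6 p) ∧
    VectorField.lieBracket ℝ zeta1 (zeta5 ε) = zeta6 ∧
    VectorField.lieBracket ℝ (zeta2 ε) (zeta5 ε) = zeta7 ε ∧
    VectorField.lieBracket ℝ zeta3 (zeta5 ε) = (fun _ => (0 : Fin 9 → ℝ)) := by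
  refine ⟨?_, ?_, ?_, ?_, ?_, ?_, ?_, ?_, ?_, ?_⟩
  · ext p i
    rw [VectorField.lieBracket_apply_pi differentiable_zeta1 (differentiable_zeta2 ε)]
    fin_cases i <;>
      simp (disch := fun_prop) [zeta1, zeta2, zeta4, xi1h, xi2h, xi3h, xi4h,
        fderiv_fun_add, fderiv_fun_sub, fderiv_fun_mul, fderiv_fun_neg, fderiv_coord_apply] <;>
      ring
  · ext p i
    rw [VectorField.lieBracket_apply_pi differentiable_zeta1 differentiable_zeta3]
    fin_cases i <;>
      simp [zeta1, zeta3]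
  · ext p i
    rw [VectorField.lieBracket_apply_pi (differentiable_zeta2 ε) differentiable_zeta3]
    fin_cases i <;>
      simp (disch := fun_prop) [zeta2, zeta3, zeta5, xi1h, xi2h, xi3h, xi4h,
        fderiv_fun_add, fderiv_fun_sub, fderiv_fun_mul, fderiv_fun_neg, fderiv_coord_apply] <;>
      ring
  · ext p i
    rw [VectorField.lieBracket_apply_pi differentiable_zeta1 differentiable_zeta4]
    fin_cases i <;>
      simp (disch := fun_prop) [zeta1, zeta4, xi2h, xi4h, fderiv_fun_add,
        fderiv_fun_mul, fderiv_fun_neg, fderiv_coord_apply]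
  · ext p i
    rw [VectorField.lieBracket_apply_pi (differentiable_zeta2 ε) differentiable_zeta4]
    fin_cases i <;>
      simp (disch := fun_prop) [zeta2, zeta4, xi1h, xi2h, xi3h, xi4h, fderiv_fun_add,
        fderiv_fun_sub, fderiv_fun_mul, fderiv_fun_neg, fderiv_coord_apply] <;>
      ring
  · ext p i
    rw [VectorField.lieBracket_apply_pi differentiable_zeta3 differentiable_zeta4]
    fin_cases i <;>
      simp (disch := fun_prop) [zeta3, zeta4, xi2h, xi4h, fderiv_fun_add,
        fderiv_fun_mul, fderiv_fun_neg, fderiv_coord_apply]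
  · funext p
    simp [zeta6]
  · ext p i
    rw [VectorField.lieBracket_apply_pi differentiable_zeta1 (differentiable_zeta5 ε)]
    fin_cases i <;>
      simp (disch := fun_prop) [zeta1, zeta5, zeta6, xi3h, xi4h, fderiv_fun_sub, fderiv_fun_mul,
        fderiv_fun_neg, fderiv_coord_apply]
  · ext p i
    rw [VectorField.lieBracket_apply_pi (differentiable_zeta2 ε) (differentiable_zeta5 ε)]
    fin_cases i <;>
      simp (disch := fun_prop) [zeta2, zeta5, zeta7, xi1h, xi2h, xi3h, xi4h,
        xi5h, xi6h, xi7h,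
        fderiv_fun_add, fderiv_fun_sub, fderiv_fun_mul, fderiv_fun_neg, fderiv_coord_apply] <;>
      ring
  · ext p i
    rw [VectorField.lieBracket_apply_pi differentiable_zeta3 (differentiable_zeta5 ε)]
    fin_cases i <;>
      simp (disch := fun_prop) [zeta3, zeta5, xi3h, xi4h, fderiv_fun_sub,
        fderiv_fun_mul, fderiv_fun_neg, fderiv_coord_apply]
end

section
/- Fix ε ∈ ℝ and consider the prolongation vector fields on ℝ⁹. Then, as equalities of maps ℝ⁹ → ℝ⁹: [ζ₁,ζ₆] = 0, [ζ₂,ζ₆] = ζ₈, [ζ₃,ζ₆] = 0, [ζ₁,ζ₇] = 2ζ₈, [ζ₃,ζ₇] = 0, [ζ₁,ζ₈] = ζ₉, and [ζ₂,ζ₇](q,θ,φ) = 3ε(1+φ)ξ̂₆(q,θ,φ) for all (q,θ,φ) ∈ ℝ⁹. (In particular the obstruction function c governing the small growth (3,5,7,8,9) versus (3,5,7,9) of the prolongation is proportional to ε(1+φ)θ, so for ε = 0 the bracket [ζ₂,ζ₇] vanishes and the distribution is of type C₃ everywhere, while for ε ≠ 0 it is of mixed type.) -/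
theorem zeta2_eq (ε : ℝ) : zeta2 ε = fun p =>
    ![1, p 8, p 5 + ε * p 3 - p 8 * (p 4 - ε * p 3), p 1 - p 8 * p 0, p 7, p 7 * p 8,
      p 7 * p 5 - p 7 * p 8 * p 4, 0, 0] := by
  ext p i
  fin_cases i <;> simp [zeta2, xi1h, xi2h, xi3h, xi4h] <;> ring

theorem zeta6_eq : zeta6 = fun p => ![0, 0, 0, 0, 0, -1, p 4, 0, 0] := by
  ext p i
  fin_cases i <;> simp [zeta6, xi4h]

theorem zeta7_eq (ε : ℝ) : zeta7 ε = fun p =>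
    ![0, 0, 2 * p 7 - ε * (p 0 + p 1), 2, 0, 0, 2 * p 7 ^ 2, 0, 0] := by
  ext p i
  fin_cases i <;> simp [zeta7, xi5h, xi6h, xi7h] <;> ring

theorem zeta8_eq : zeta8 = fun p => ![0, 0, 1, 0, 0, 0, 2 * p 7, 0, 0] := by
  ext p i
  fin_cases i <;> simp [zeta8, xi6h, xi7h] ; ring

/-- A differentiable map into a finite power of `ℝ` has its Fréchet derivative computed
coordinatewise along lines. -/
theorem fderiv_eq_of_hasDerivAt_line {ι : Type*} [Fintype ι] {E : Type*}
    [NormedAddCommGroup E] [NormedSpace ℝ E] {F : E → ι → ℝ} {p v : E} {a : ι → ℝ}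
    (hF : DifferentiableAt ℝ F p)
    (h : ∀ i, HasDerivAt (fun r : ℝ => F (p + r • v) i) (a i) 0) :
    fderiv ℝ F p v = a :=
  (hF.hasFDerivAt.hasLineDerivAt v).unique (hasDerivAt_pi.2 h)

theorem differentiable_zeta6 : Differentiable ℝ zeta6 := by
  rw [zeta6_eq, differentiable_pi]
  intro i
  fin_cases i <;> simp; fun_prop

theorem differentiable_zeta7 (ε : ℝ) : Differentiable ℝ (zeta7 ε) := by
  rw [zeta7_eq, differentiable_pi]
  intro i
  fin_cases i <;> simp <;> fun_prop

theorem differentiable_zeta8 : Differentiable ℝ zeta8 := by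
  rw [zeta8_eq, differentiable_pi]
  intro i
  fin_cases i <;> simp; fun_prop

theorem fderiv_zeta1 (p v : Fin 9 → ℝ) : fderiv ℝ zeta1 p v = 0 := by
  simp [show zeta1 = fun _ => ![0, 0, 0, 0, 0, 0, 0, 1, 0] from rfl]

theorem fderiv_zeta3 (p v : Fin 9 → ℝ) : fderiv ℝ zeta3 p v = 0 := by
  simp [show zeta3 = fun _ => ![0, 0, 0, 0, 0, 0, 0, 0, 1] from rfl]

/-- The derivative of a coordinate function along a line. -/
theorem hasDerivAt_line_apply {ι : Type*} (p v : ι → ℝ) (j : ι) :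
    HasDerivAt (fun r : ℝ => p j + r * v j) (v j) 0 := by
  simpa using ((hasDerivAt_id (0 : ℝ)).mul_const (v j)).const_add (p j)

theorem fderiv_zeta2 (ε : ℝ) (p v : Fin 9 → ℝ) : fderiv ℝ (zeta2 ε) p v =
    ![0, v 8, v 5 + ε * v 3 - (v 8 * (p 4 - ε * p 3) + p 8 * (v 4 - ε * v 3)),
      v 1 - (v 8 * p 0 + p 8 * v 0), v 7, v 7 * p 8 + p 7 * v 8,
      v 7 * p 5 + p 7 * v 5 - ((v 7 * p 8 + p 7 * v 8) * p 4 + p 7 * p 8 * v 4), 0, 0] := by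
  refine fderiv_eq_of_hasDerivAt_line (differentiable_zeta2 ε p) fun i => ?_
  have h := hasDerivAt_line_apply p v
  rw [zeta2_eq]
  fin_cases i
  · simpa using hasDerivAt_const (0 : ℝ) (1 : ℝ)
  · simpa using h 8
  · simpa using ((h 5).fun_add ((h 3).const_mul ε)).fun_sub
      ((h 8).fun_mul ((h 4).fun_sub ((h 3).const_mul ε)))
  · simpa using (h 1).fun_sub ((h 8).fun_mul (h 0))
  · simpa using h 7
  · simpa using (h 7).fun_mul (h 8)
  · simpa using ((h 7).fun_mul (h 5)).fun_sub (((h 7).fun_mul (h 8)).fun_mul (h 4))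
  · simpa using hasDerivAt_const (0 : ℝ) (0 : ℝ)
  · simpa using hasDerivAt_const (0 : ℝ) (0 : ℝ)

theorem fderiv_zeta6 (p v : Fin 9 → ℝ) : fderiv ℝ zeta6 p v =
    ![0, 0, 0, 0, 0, 0, v 4, 0, 0] := by
  refine fderiv_eq_of_hasDerivAt_line (differentiable_zeta6 p) fun i => ?_
  have h := hasDerivAt_line_apply p v
  rw [zeta6_eq]
  fin_cases i <;> simp [hasDerivAt_const, h]

theorem fderiv_zeta7 (ε : ℝ) (p v : Fin 9 → ℝ) : fderiv ℝ (zeta7 ε) p v =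
    ![0, 0, 2 * v 7 - ε * (v 0 + v 1), 0, 0, 0, 4 * p 7 * v 7, 0, 0] := by
  refine fderiv_eq_of_hasDerivAt_line (differentiable_zeta7 ε p) fun i => ?_
  have h := hasDerivAt_line_apply p v
  rw [zeta7_eq]
  fin_cases i <;> simp [hasDerivAt_const]
  · exact ((h 7).const_mul 2).fun_sub (((h 0).fun_add (h 1)).const_mul ε)
  · exact (((h 7).fun_pow 2).const_mul 2).congr_deriv (by simp; ring)

theorem fderiv_zeta8 (p v : Fin 9 → ℝ) : fderiv ℝ zeta8 p v =
    ![0, 0, 0, 0, 0, 0, 2 * v 7, 0, 0] := by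
  refine fderiv_eq_of_hasDerivAt_line (differentiable_zeta8 p) fun i => ?_
  have h := hasDerivAt_line_apply p v
  rw [zeta8_eq]
  fin_cases i <;> simp [hasDerivAt_const]
  exact (h 7).const_mul 2

/-- Second-level bracket relations of the prolongation of the ε-family:
[ζ₁,ζ₆] = 0, [ζ₂,ζ₆] = ζ₈, [ζ₃,ζ₆] = 0, [ζ₁,ζ₇] = 2ζ₈, [ζ₃,ζ₇] = 0,
[ζ₁,ζ₈] = ζ₉, and [ζ₂,ζ₇](q,θ,φ) = 3ε(1+φ)ξ̂₆(q,θ,φ) at every point. The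
obstruction governing small growth (3,5,7,8,9) versus (3,5,7,9) is
proportional to ε(1+φ)θ. -/
theorem prolongation_higher_brackets (ε : ℝ) :
    VectorField.lieBracket ℝ zeta1 zeta6 = (fun _ => (0 : Fin 9 → ℝ)) ∧
    VectorField.lieBracket ℝ (zeta2 ε) zeta6 = zeta8 ∧
    VectorField.lieBracket ℝ zeta3 zeta6 = (fun _ => (0 : Fin 9 → ℝ)) ∧
    VectorField.lieBracket ℝ zeta1 (zeta7 ε) = (fun p => (2 : ℝ) • zeta8 p) ∧
    VectorField.lieBracket ℝ zeta3 (zeta7 ε) = (fun _ => (0 : Fin 9 → ℝ)) ∧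
    VectorField.lieBracket ℝ zeta1 zeta8 = zeta9 ∧
    (∀ p : Fin 9 → ℝ,
      VectorField.lieBracket ℝ (zeta2 ε) (zeta7 ε) p =
        (3 * ε * (1 + p 8)) • xi6h p) := by
  refine ⟨?_, ?_, ?_, ?_, ?_, ?_, fun p => ?_⟩
  · ext p i
    rw [VectorField.lieBracket, fderiv_zeta6, fderiv_zeta1]
    fin_cases i <;> simp [zeta1]
  · ext p i
    rw [VectorField.lieBracket, fderiv_zeta6, fderiv_zeta2]
    fin_cases i <;> simp [zeta2_eq, zeta6_eq, zeta8_eq] ; ring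
  · ext p i
    rw [VectorField.lieBracket, fderiv_zeta6, fderiv_zeta3]
    fin_cases i <;> simp [zeta3]
  · ext p i
    rw [VectorField.lieBracket, fderiv_zeta7, fderiv_zeta1]
    fin_cases i <;> simp [zeta1, zeta8_eq] ; ring
  · ext p i
    rw [VectorField.lieBracket, fderiv_zeta7, fderiv_zeta3]
    fin_cases i <;> simp [zeta3]
  · ext p i
    rw [VectorField.lieBracket, fderiv_zeta8, fderiv_zeta1]
    fin_cases i <;> simp [zeta1, zeta9, xi7h]
  · ext i
    rw [VectorField.lieBracket, fderiv_zeta7, fderiv_zeta2]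
    fin_cases i <;> simp [zeta2_eq, zeta7_eq, xi6h] ; ring
end

section
/- Fix ε ∈ ℝ. At every point of ℝ⁹, the nine vectors ζ₁, ζ₂, ζ₃, ζ₄, ζ₅, ζ₆, ζ₇, ζ₈, ζ₉ of the prolongation of the ε-family, evaluated at that point, form a basis of ℝ⁹. (Hence the prolonged distribution E = span{ζ₁,ζ₂,ζ₃} has weak derived flag of ranks 3, 5, 7, and its iterated brackets span the full tangent space ℝ⁹ at every point.) -/
/-- For every ε and every point p ∈ ℝ⁹, the nine vectors ζ₁(p),…,ζ₉(p) of the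
prolongation of the ε-family form a basis of ℝ⁹: the prolonged distribution
E = span{ζ₁,ζ₂,ζ₃} together with its iterated brackets spans the full
tangent space at every point. -/
theorem prolongation_frame (ε : ℝ) (p : Fin 9 → ℝ) :
    LinearIndependent ℝ
        ![zeta1 p, zeta2 ε p, zeta3 p, zeta4 p, zeta5 ε p, zeta6 p,
          zeta7 ε p, zeta8 p, zeta9 p] ∧
      Submodule.span ℝ
        (Set.range ![zeta1 p, zeta2 ε p, zeta3 p, zeta4 p, zeta5 ε p, zeta6 p,
          zeta7 ε p, zeta8 p, zeta9 p]) = ⊤ := by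
  have h : LinearIndependent ℝ
      ![zeta1 p, zeta2 ε p, zeta3 p, zeta4 p, zeta5 ε p, zeta6 p,
        zeta7 ε p, zeta8 p, zeta9 p] := by
    rw [Fintype.linearIndependent_iff]
    intro g hg
    have hx := congrFun hg 0
    have hy := congrFun hg 1
    have hs := congrFun hg 2
    have ht := congrFun hg 3
    have hz := congrFun hg 4
    have hw := congrFun hg 5
    have hu := congrFun hg 6
    have hθ := congrFun hg 7
    have hφ := congrFun hg 8
    simp [Fin.sum_univ_succ, zeta1, zeta2, zeta3, zeta4, zeta5, zeta6, zeta7, zeta8, zeta9,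
      xi1h, xi2h, xi3h, xi4h, xi5h, xi6h, xi7h] at hx hy hs ht hz hw hu hθ hφ
    have h3 : g 3 = 0 := by simpa [hx] using hz
    have h4 : g 4 = 0 := by simpa [hx] using hy
    have h5 : g 5 = 0 := by simpa [hx, h3, h4] using hw
    have h6 : g 6 = 0 := by simpa [hx, h4] using ht
    have h7 : g 7 = 0 := by simpa [hx, h4, h6] using hs
    have h8 : g 8 = 0 := by simpa [hx, h3, h4, h5, h6, h7] using hu
    intro i
    fin_cases i <;> assumption
  exact ⟨h, h.span_eq_top_of_card_eq_finrank' (by simp)⟩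
end

section
/- Fix ε ∈ ℝ. At every point z ∈ ℝ⁹, the four vectors ζ₂(z), ζ₃(z), ζ₅(z), ζ₇(z) are linearly independent, and moreover ζ₂(z), ζ₃(z) are linearly independent and ζ₂(z), ζ₃(z), ζ₅(z) are linearly independent. (Combined with [ζ₂,ζ₃] = ζ₅ and [ζ₂,ζ₅] = ζ₇, this gives the small growth (2,3,4) of the rank-2 distribution F = span{ζ₂,ζ₃}, i.e., the Engel property of F restricted to the leaves of the foliation it generates.) -/
/-- For every ε and every point z ∈ ℝ⁹, the vectors ζ₂(z), ζ₃(z), ζ₅(z), ζ₇(z)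
are linearly independent, as are ζ₂(z), ζ₃(z) and ζ₂(z), ζ₃(z), ζ₅(z): the
small growth (2,3,4) (Engel property) of F = span{ζ₂,ζ₃} along the leaves of
the foliation it generates. -/
theorem engel_growth (ε : ℝ) (z : Fin 9 → ℝ) :
    LinearIndependent ℝ ![zeta2 ε z, zeta3 z, zeta5 ε z, zeta7 ε z] ∧
    LinearIndependent ℝ ![zeta2 ε z, zeta3 z] ∧
    LinearIndependent ℝ ![zeta2 ε z, zeta3 z, zeta5 ε z] := by
  have h : LinearIndependent ℝ ![zeta2 ε z, zeta3 z, zeta5 ε z, zeta7 ε z] := by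
    rw [Fintype.linearIndependent_iff]
    intro g hg
    have h0 := congrFun hg 0
    have h1 := congrFun hg 1
    have h3 := congrFun hg 3
    have h8 := congrFun hg 8
    simp [Fin.sum_univ_four, zeta2, zeta3, zeta5, zeta7, xi1h, xi2h, xi3h, xi4h, xi5h, xi6h,
      xi7h] at h0 h1 h3 h8
    have h2 : g 2 = 0 := by simpa [h0] using h1
    have h4 : g 3 = 0 := by simpa [h0, h2] using h3
    intro i
    fin_cases i <;> assumption
  have restrict (n : ℕ) (hn : n ≤ 4) := h.comp _ (Fin.castLE_injective hn)
  refine ⟨h, ?_, ?_⟩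
  · convert restrict 2 (by norm_num) using 1
    funext i
    fin_cases i <;> rfl
  · convert restrict 3 (by norm_num) using 1
    funext i
    fin_cases i <;> rfl
end
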